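/- Let s be a positive integer. Then the sum of the sizes of all (s, s+1)-core partitions equals (C(s+1, 3)/2) · Cat(s), where Cat(s) = C(2s, s)/(s+1) is the s-th Catalan number; equivalently, the average size of an (s, s+1)-core partition is C(s+1, 3)/2. -/

import Mathlib

/-- A partition, given by its (0-indexed) weakly decreasing sequence of parts,
which is eventually zero. Row `i` of the Young diagram has `parts i` cells;
the diagram consists of the (0-indexed) cells `(i, j)` with `j < parts i`. -/
structure YPartition where
  parts : ℕ → ℕ
  antitone : ∀ ⦃i j : ℕ⦄, i ≤ j → parts j ≤ parts i
  finite_support : ∃ N, ∀ i, N ≤ i → parts i = 0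

namespace YPartition

/-- The `j`-th (0-indexed) part of the conjugate partition: the number of rows
whose length exceeds `j`. -/
noncomputable def conj (p : YPartition) (j : ℕ) : ℕ := Set.ncard {i : ℕ | j < p.parts i}

/-- The set of (0-indexed) cells of the Young diagram. -/
def cells (p : YPartition) : Set (ℕ × ℕ) := {c | c.2 < p.parts c.1}

/-- The size of a partition: the number of cells of its Young diagram. -/
noncomputable def size (p : YPartition) : ℕ := p.cells.ncard

/-- The hook length of the (0-indexed) cell `(i, j)`:
`λ_i − j + λ'_j − i + 1` in 1-indexed terms. -/
noncomputable def hook (p : YPartition) (i j : ℕ) : ℕ := p.parts i + p.conj j - i - j - 1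

/-- A partition is self-conjugate if it equals its conjugate. -/
def SelfConj (p : YPartition) : Prop := ∀ j, p.conj j = p.parts j

/-- A partition is a `t`-core if no cell of its diagram has hook length `t`. -/
def IsCore (t : ℕ) (p : YPartition) : Prop :=
  ∀ i j : ℕ, (i, j) ∈ p.cells → p.hook i j ≠ t

/-- The set of hook lengths of the main diagonal cells. -/
def MD (p : YPartition) : Set ℕ := {h | ∃ i : ℕ, i < p.parts i ∧ h = p.hook i i}

end YPartition

section AcsHelpers

open Finset


theorem acs_sum_zmod {s : ℕ} [NeZero s] (f : ZMod s → ℤ) :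
    ∑ r, f r = ∑ k ∈ range s, f (k : ZMod s) := by
  symm
  refine Finset.sum_nbij' (fun k => (k : ZMod s)) (fun r => r.val) ?_ ?_ ?_ ?_ ?_
  · simp
  · intro r _; simpa using ZMod.val_lt r
  · intro k hk; exact ZMod.val_cast_of_lt (by simpa using hk)
  · intro r _; simp
  · simp

section
variable {ι : Type*} [Fintype ι] [DecidableEq ι]

theorem acs_shift (n : ℕ) (i j : ι) (hij : i ≠ j) :
    ∑ z ∈ piAntidiag (univ : Finset ι) n, ((z i : ℤ) * (z i - 1) * (z j + 1))
    = ∑ z ∈ piAntidiag (univ : Finset ι) n, (((z i : ℤ) + 1) * z i * z j) := by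
  classical
  rw [← Finset.sum_filter_of_ne (p := fun z => 1 ≤ z i),
    ← Finset.sum_filter_of_ne (s := piAntidiag (univ : Finset ι) n) (p := fun z => 1 ≤ z j) (f := fun z => ((z i : ℤ) + 1) * z i * z j)]
  · refine Finset.sum_nbij' (fun z k => if k = i then z i - 1 else if k = j then z j + 1 else z k)
      (fun z k => if k = i then z i + 1 else if k = j then z j - 1 else z k) ?_ ?_ ?_ ?_ ?_
    · intro z hz
      simp only [mem_filter, mem_piAntidiag, mem_univ, implies_true, and_true] at hz ⊢
      refine ⟨?_, by simp [hij.symm]⟩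
      have hz1 := hz.1
      change ∑ x, z x = n at hz1
      rw [← hz1]
      rw [← Finset.add_sum_erase _ _ (mem_univ i), ← Finset.add_sum_erase _ (fun x => z x) (mem_univ i),
        ← Finset.add_sum_erase _ _ (mem_erase.2 ⟨hij.symm, mem_univ j⟩),
        ← Finset.add_sum_erase _ (fun x => z x) (mem_erase.2 ⟨hij.symm, mem_univ j⟩)]
      rw [Finset.sum_congr (g := fun x => z x) rfl]
      · simp [hij.symm]; omega
      · intro x hx; simp at hx; simp [hx]
    · intro z hz
      simp only [mem_filter, mem_piAntidiag, mem_univ, implies_true, and_true] at hz ⊢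
      refine ⟨?_, by simp⟩
      have hz1 := hz.1
      change ∑ x, z x = n at hz1
      rw [← hz1]
      rw [← Finset.add_sum_erase _ _ (mem_univ i), ← Finset.add_sum_erase _ (fun x => z x) (mem_univ i),
        ← Finset.add_sum_erase _ _ (mem_erase.2 ⟨hij.symm, mem_univ j⟩),
        ← Finset.add_sum_erase _ (fun x => z x) (mem_erase.2 ⟨hij.symm, mem_univ j⟩)]
      rw [Finset.sum_congr (g := fun x => z x) rfl]
      · simp [hij.symm]; omega
      · intro x hx; simp at hx; simp [hx]
    · intro z hz
      simp only [mem_filter, mem_piAntidiag, mem_univ, implies_true, and_true] at hz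
      funext k
      by_cases h1 : k = i
      · subst h1; simp; omega
      · by_cases h2 : k = j
        · subst h2; simp [h1]
        · simp [h1, h2]
    · intro z hz
      simp only [mem_filter, mem_piAntidiag, mem_univ, implies_true, and_true] at hz
      funext k
      by_cases h1 : k = i
      · subst h1; simp
      · by_cases h2 : k = j
        · subst h2; simp [h1]; omega
        · simp [h1, h2]
    · intro z hz
      simp only [mem_filter, mem_piAntidiag, mem_univ, implies_true, and_true] at hz
      simp only [if_true, hij.symm, if_false]
      push_cast [hz.2]
      ring
  · intro z _ h
    by_contra h'
    apply h
    have : z j = 0 := by omega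
    simp [this]
  · intro z _ h
    by_contra h'
    apply h
    have : z i = 0 := by omega
    simp [this]

theorem acs_perm (n : ℕ) (σ : Equiv.Perm ι) (f : (ι → ℕ) → ℤ) :
    ∑ z ∈ piAntidiag (univ : Finset ι) n, f (z ∘ σ) = ∑ z ∈ piAntidiag (univ : Finset ι) n, f z := by
  refine Finset.sum_nbij' (fun z => z ∘ σ) (fun z => z ∘ σ.symm) ?_ ?_ ?_ ?_ ?_
  · intro z hz
    simp only [mem_piAntidiag, mem_univ, implies_true, and_true] at hz ⊢
    rw [← hz]; exact Equiv.sum_comp σ z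
  · intro z hz
    simp only [mem_piAntidiag, mem_univ, implies_true, and_true] at hz ⊢
    rw [← hz]; exact Equiv.sum_comp σ.symm z
  · intro z _; funext k; simp
  · intro z _; funext k; simp
  · intro z _; rfl

theorem acs_cross (n : ℕ) (i j : ι) (hij : i ≠ j) :
    ∑ z ∈ piAntidiag (univ : Finset ι) n, (z i : ℤ) ^ 2
    = ∑ z ∈ piAntidiag (univ : Finset ι) n, (z i : ℤ)
      + 2 * ∑ z ∈ piAntidiag (univ : Finset ι) n, (z i : ℤ) * z j := by
  have h := acs_shift n i j hij
  rw [← sub_eq_zero, ← Finset.sum_sub_distrib] at h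
  rw [← sub_eq_zero, Finset.mul_sum, ← Finset.sum_add_distrib, ← Finset.sum_sub_distrib, ← h]
  apply Finset.sum_congr rfl
  intro z _
  ring

theorem acs_first (n : ℕ) (i : ι) :
    (Fintype.card ι : ℤ) * ∑ z ∈ piAntidiag (univ : Finset ι) n, (z i : ℤ)
    = n * (piAntidiag (univ : Finset ι) n).card := by
  have h1 : ∀ j, ∑ z ∈ piAntidiag (univ : Finset ι) n, (z j : ℤ) = ∑ z ∈ piAntidiag (univ : Finset ι) n, (z i : ℤ) := by
    intro j
    rw [← acs_perm n (Equiv.swap i j)]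
    simp
  have h2 : ∑ j, ∑ z ∈ piAntidiag (univ : Finset ι) n, (z j : ℤ) = n * (piAntidiag (univ : Finset ι) n).card := by
    rw [Finset.sum_comm, Finset.sum_congr rfl (g := fun _ => (n : ℤ))]
    · simp [mul_comm]
    · intro z hz
      simp only [mem_piAntidiag, mem_univ, implies_true, and_true] at hz
      rw [← hz]; push_cast; rfl
  rw [← h2, Finset.sum_congr rfl (fun j _ => h1 j)]
  simp

/-- second moments when n = card + 1 -/
theorem acs_mixed (n : ℕ) (hn : n = Fintype.card ι + 1) (i j : ι) (hij : i ≠ j) :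
    ∑ z ∈ piAntidiag (univ : Finset ι) n, (z i : ℤ) * z j = (piAntidiag (univ : Finset ι) n).card := by
  have h1 : ∀ k, k ≠ i → ∑ z ∈ piAntidiag (univ : Finset ι) n, (z i : ℤ) * z k
      = ∑ z ∈ piAntidiag (univ : Finset ι) n, (z i : ℤ) * z j := by
    intro k hk
    rw [← acs_perm n (Equiv.swap k j)]
    simp [Equiv.swap_apply_of_ne_of_ne hk.symm hij]
  have h2 : ∑ k, ∑ z ∈ piAntidiag (univ : Finset ι) n, (z i : ℤ) * z k
      = n * ∑ z ∈ piAntidiag (univ : Finset ι) n, (z i : ℤ) := by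
    rw [Finset.sum_comm, Finset.mul_sum]
    apply Finset.sum_congr rfl
    intro z hz
    simp only [mem_piAntidiag, mem_univ, implies_true, and_true] at hz
    rw [← Finset.mul_sum, ← hz]; push_cast; ring
  rw [← Finset.add_sum_erase _ _ (mem_univ i), Finset.sum_congr (s₁ := univ.erase i) rfl
    (fun k hk => h1 k (by simpa using hk))] at h2
  rw [Finset.sum_const, Finset.card_erase_of_mem (mem_univ i), Finset.card_univ] at h2
  have h3 := acs_cross n i j hij
  have h4 := acs_first n i
  have hc : 0 < Fintype.card ι := Fintype.card_pos_iff.2 ⟨i⟩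
  simp only [← pow_two] at h2
  rw [h3] at h2
  subst hn
  generalize (∑ z ∈ piAntidiag (univ : Finset ι) (Fintype.card ι + 1), (z i : ℤ) * z j) = B at *
  generalize (∑ z ∈ piAntidiag (univ : Finset ι) (Fintype.card ι + 1), (z i : ℤ)) = T at *
  generalize ((piAntidiag (univ : Finset ι) (Fintype.card ι + 1)).card : ℤ) = N at *
  generalize Fintype.card ι = s at *
  simp only [nsmul_eq_mul] at h2
  push_cast [Nat.cast_sub hc] at h2 h4
  have : ((s : ℤ) + 1) * B = (s + 1) * N := by linarith
  exact mul_left_cancel₀ (by positivity) this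
end

section

theorem acs_card {ι : Type*} [Fintype ι] [DecidableEq ι] (n : ℕ) :
    (piAntidiag (univ : Finset ι) n).card = (Fintype.card ι + n - 1).choose n := by
  rw [← Finset.card_univ (α := ι), ← Finset.card_finsuppAntidiag_nat_eq_choose]
  symm
  refine Finset.card_bij (fun f _ => (f : ι → ℕ)) ?_ ?_ ?_
  · intro f hf
    simp [Finset.mem_finsuppAntidiag] at hf ⊢
    exact hf
  · intro f _ g _ h
    exact DFunLike.coe_injective h
  · intro z hz
    refine ⟨Finsupp.equivFunOnFinite.symm z, ?_, ?_⟩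
    · simp [Finset.mem_finsuppAntidiag] at hz ⊢
      exact hz
    · simp

/-- the comps -/
def acsZ (s : ℕ) [NeZero s] : Finset (ZMod s → ℕ) := piAntidiag univ (s + 1)

/-- step -/
def acsW {s : ℕ} (z : ZMod s → ℕ) (r : ZMod s) : ℤ := (s : ℤ) + 1 - s * z r

variable {s : ℕ} [NeZero s]

theorem acs_memZ (z : ZMod s → ℕ) : z ∈ acsZ s ↔ ∑ r, z r = s + 1 := by
  simp [acsZ, mem_piAntidiag]

theorem acs_sumW (z : ZMod s → ℕ) (hz : z ∈ acsZ s) : ∑ r, acsW z r = 0 := by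
  rw [acs_memZ] at hz
  unfold acsW
  rw [Finset.sum_sub_distrib, ← Finset.mul_sum, ← Nat.cast_sum, hz]
  simp [ZMod.card]

theorem acs_WW_ne (k l : ZMod s) (h : k ≠ l) :
    ∑ z ∈ acsZ s, acsW z k * acsW z l = - (2 * s + 1) * (acsZ s).card := by
  have h1 := acs_first (ι := ZMod s) (s + 1) k
  have h2 := acs_first (ι := ZMod s) (s + 1) l
  have h3 := acs_mixed (ι := ZMod s) (s + 1) (by rw [ZMod.card]) k l h
  change _ = (((acsZ s).card : ℕ) : ℤ) at h3
  change _ = ((s + 1 : ℕ) : ℤ) * (((acsZ s).card : ℕ) : ℤ) at h1 h2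
  rw [ZMod.card] at h1 h2
  have : ∀ z : ZMod s → ℕ, acsW z k * acsW z l = ((s : ℤ) + 1) ^ 2 - (s + 1) * s * z k - (s + 1) * s * z l
      + s ^ 2 * (z k * z l) := by intro z; unfold acsW; ring
  simp only [this, Finset.sum_add_distrib, Finset.sum_sub_distrib, ← Finset.mul_sum]
  change ∑ z ∈ acsZ s, _ = _ at h3
  change (s : ℤ) * ∑ z ∈ acsZ s, _ = _ at h1 h2
  rw [h3, mul_assoc, mul_assoc, h1, h2]
  simp only [Finset.sum_const, nsmul_eq_mul]
  push_cast
  ring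

theorem acs_WW (k l : ZMod s) :
    ∑ z ∈ acsZ s, acsW z k * acsW z l = (2 * s + 1) * (acsZ s).card * ((if k = l then (s : ℤ) else 0) - 1) := by
  by_cases h : k = l
  · subst h
    have h0 : ∑ l, ∑ z ∈ acsZ s, acsW z k * acsW z l = 0 := by
      rw [Finset.sum_comm]
      apply Finset.sum_eq_zero
      intro z hz
      rw [← Finset.mul_sum, acs_sumW z hz, mul_zero]
    rw [← Finset.add_sum_erase _ _ (mem_univ k), Finset.sum_congr (s₁ := univ.erase k) rfl
      (fun l hl => acs_WW_ne k l (by simpa using (Finset.ne_of_mem_erase hl).symm))] at h0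
    rw [Finset.sum_const, Finset.card_erase_of_mem (mem_univ k), Finset.card_univ, ZMod.card,
      nsmul_eq_mul, Nat.cast_sub (Nat.one_le_iff_ne_zero.2 (NeZero.ne s))] at h0
    push_cast at h0
    simp only [if_true]
    linarith
  · rw [acs_WW_ne k l h, if_neg h]; ring

theorem acs_arc (i : ZMod s) (d : ℕ) (hd : d ≤ s) :
    ∑ z ∈ acsZ s, (∑ k ∈ range d, acsW z (i + (k + 1 : ℕ))) ^ 2
      = (2 * s + 1) * (acsZ s).card * (d * (s - d)) := by
  simp only [pow_two, Finset.sum_mul_sum]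
  rw [Finset.sum_comm]
  simp_rw [Finset.sum_comm (s := acsZ s)]
  have : ∀ k ∈ range d, ∑ y ∈ range d, ∑ x ∈ acsZ s, acsW x (i + (k + 1 : ℕ)) * acsW x (i + (y + 1 : ℕ))
     = (2 * s + 1) * (acsZ s).card * (s - d) := by
    intro k hk
    simp_rw [acs_WW, ← Finset.mul_sum]
    congr 1
    rw [Finset.sum_sub_distrib]
    have : ∀ y ∈ range d, (if i + ((k + 1 : ℕ) : ZMod s) = i + ((y + 1 : ℕ) : ZMod s) then (s : ℤ) else 0) =
        if k = y then (s : ℤ) else 0 := by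
      intro y hy
      simp only [mem_range] at hk hy
      congr 1
      apply propext
      constructor
      · intro h
        have h := add_left_cancel h
        push_cast at h
        have h := add_right_cancel h
        have := congrArg ZMod.val h
        rwa [ZMod.val_cast_of_lt (by omega), ZMod.val_cast_of_lt (by omega)] at this
      · rintro rfl; rfl
    rw [Finset.sum_congr rfl this, Finset.sum_ite_eq, if_pos hk]
    simp
  rw [Finset.sum_congr rfl this]
  simp
  ring

/-- partial sums -/
def acsq (z : ZMod s → ℕ) (r : ZMod s) : ℤ := r.val - ∑ k ∈ range r.val, (z ((k + 1 : ℕ) : ZMod s) : ℤ)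

def acse (z : ZMod s → ℕ) (r : ZMod s) : ℤ := r.val + s * acsq z r

theorem acse_eq (z : ZMod s → ℕ) (r : ZMod s) : acse z r = ∑ k ∈ range r.val, acsW z ((k + 1 : ℕ) : ZMod s) := by
  unfold acse acsq acsW
  rw [Finset.sum_sub_distrib, ← Finset.mul_sum]
  simp
  ring

theorem acse_zero (z : ZMod s → ℕ) : acse z 0 = 0 := by
  rw [acse_eq]; simp

theorem acse_cast (z : ZMod s → ℕ) (r : ZMod s) : ((acse z r : ℤ) : ZMod s) = r := by
  unfold acse; simp

theorem acse_step (z : ZMod s → ℕ) (hz : z ∈ acsZ s) (r : ZMod s) :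
    acse z (r + 1) = acse z r + acsW z (r + 1) := by
  have hr : ((r.val + 1 : ℕ) : ZMod s) = r + 1 := by simp
  by_cases h : r.val + 1 < s
  · have : (r + 1).val = r.val + 1 := by
      rw [← hr, ZMod.val_cast_of_lt h]
    rw [acse_eq, acse_eq, this, Finset.sum_range_succ, hr]
  · have h' : r.val + 1 = s := by have := ZMod.val_lt r; omega
    have h0 : r + 1 = 0 := by rw [← hr, h']; simp
    have h1 : ∑ k ∈ range s, acsW z ((k + 1 : ℕ) : ZMod s) = 0 := by
      rw [← acs_sumW z hz, ← Equiv.sum_comp (Equiv.addRight (1 : ZMod s)), acs_sum_zmod]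
      simp
    rw [← hr, acse_eq z r, ← Finset.sum_range_succ (fun k => acsW z ((k + 1 : ℕ) : ZMod s)), h', h1]
    simp [acse_zero]

theorem acs_steps (e w : ZMod s → ℤ) (h : ∀ r, e (r + 1) = e r + w (r + 1)) (i : ZMod s) (d : ℕ) :
    e (i + d) = e i + ∑ k ∈ range d, w (i + (k + 1 : ℕ)) := by
  induction d with
  | zero => simp
  | succ d ih =>
    rw [Finset.sum_range_succ, ← add_assoc, ← ih]
    push_cast
    rw [← add_assoc, h]

theorem acs_ext (e e' w : ZMod s → ℤ) (h : ∀ r, e (r + 1) = e r + w (r + 1))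
    (h' : ∀ r, e' (r + 1) = e' r + w (r + 1)) (r : ZMod s) : e r - e 0 = e' r - e' 0 := by
  have h1 := acs_steps e w h 0 r.val
  have h2 := acs_steps e' w h' 0 r.val
  simp only [zero_add, ZMod.natCast_zmod_val] at h1 h2
  rw [h1, h2]; ring

/-- spread -/
def acsV (e : ZMod s → ℤ) : ℤ := ∑ i, ∑ j, (e j - e i) ^ 2

theorem acsV_eq (e : ZMod s → ℤ) : acsV e = 2 * s * ∑ i, e i ^ 2 - 2 * (∑ i, e i) ^ 2 := by
  unfold acsV
  have : ∀ i j, (e j - e i) ^ 2 = e j ^ 2 + e i ^ 2 - 2 * (e i * e j) := by intros; ring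
  simp only [this, Finset.sum_sub_distrib, Finset.sum_add_distrib, ← Finset.mul_sum, ← Finset.sum_mul]
  simp [ZMod.card]
  rw [← Finset.mul_sum]
  ring

theorem acs_sum_d (n : ℕ) (S : ℤ) : 6 * ∑ d ∈ range n, ((d : ℤ) * (S - d)) = 3 * S * n * (n - 1) - n * (n - 1) * (2 * n - 1) := by
  induction n with
  | zero => simp
  | succ n ih => rw [Finset.sum_range_succ, mul_add, ih]; push_cast; ring

theorem acs_sumV : 6 * ∑ z ∈ acsZ s, acsV (acse z) = (2 * s + 1) * (acsZ s).card * (s ^ 2 * (s ^ 2 - 1)) := by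
  unfold acsV
  rw [Finset.sum_comm]
  have : ∀ i : ZMod s, ∑ z ∈ acsZ s, ∑ j, (acse z j - acse z i) ^ 2
      = (2 * s + 1) * (acsZ s).card * ∑ d ∈ range s, ((d : ℤ) * (s - d)) := by
    intro i
    have : ∀ z ∈ acsZ s, ∑ j, (acse z j - acse z i) ^ 2
        = ∑ d ∈ range s, (∑ k ∈ range d, acsW z (i + (k + 1 : ℕ))) ^ 2 := by
      intro z hz
      rw [← Equiv.sum_comp (Equiv.addLeft i), acs_sum_zmod]
      apply Finset.sum_congr rfl
      intro d _
      simp only [Equiv.coe_addLeft]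
      rw [acs_steps (acse z) (acsW z) (acse_step z hz) i d]
      ring
    rw [Finset.sum_congr rfl this, Finset.sum_comm, Finset.mul_sum]
    apply Finset.sum_congr rfl
    intro d hd
    exact acs_arc i d (by simp at hd; omega)
  rw [Finset.sum_congr rfl (fun i _ => this i)]
  have h := acs_sum_d s s
  simp only [Finset.sum_const, Finset.card_univ, ZMod.card, nsmul_eq_mul]
  linear_combination (s : ℤ) * (2 * s + 1) * (acsZ s).card * h

/-- class -/
def acsc (z : ZMod s → ℕ) : ℤ := ∑ r, acsq z r

theorem acsc_eq (z : ZMod s → ℕ) : ∑ r, acse z r = ∑ r : ZMod s, (r.val : ℤ) + s * acsc z := by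
  unfold acse acsc
  rw [Finset.sum_add_distrib, ← Finset.mul_sum]

theorem acs_rot_mem (z : ZMod s → ℕ) (hz : z ∈ acsZ s) : (z ∘ Equiv.addRight (1 : ZMod s)) ∈ acsZ s := by
  rw [acs_memZ] at *
  rw [← hz]
  exact Equiv.sum_comp (Equiv.addRight (1 : ZMod s)) z

theorem acs_rot_e (z : ZMod s → ℕ) (hz : z ∈ acsZ s) (r : ZMod s) :
    acse (z ∘ Equiv.addRight (1 : ZMod s)) r = acse z (r + 1) - acse z 1 := by
  have := acs_ext (acse (z ∘ Equiv.addRight (1 : ZMod s))) (fun r => acse z (r + 1))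
    (acsW (z ∘ Equiv.addRight (1 : ZMod s))) (acse_step _ (acs_rot_mem z hz))
    (by intro r; rw [acse_step z hz]; rfl) r
  simpa [acse_zero] using this

theorem acs_rot_V (z : ZMod s → ℕ) (hz : z ∈ acsZ s) :
    acsV (acse (z ∘ Equiv.addRight (1 : ZMod s))) = acsV (acse z) := by
  unfold acsV
  simp only [acs_rot_e z hz, sub_sub_sub_cancel_right]
  rw [← Equiv.sum_comp (Equiv.addRight (1 : ZMod s)) (fun i => ∑ j, (acse z j - acse z i) ^ 2)]
  apply Finset.sum_congr rfl
  intro i _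
  rw [← Equiv.sum_comp (Equiv.addRight (1 : ZMod s)) (fun j => (acse z j - _) ^ 2)]
  rfl

theorem acs_rot_c (z : ZMod s → ℕ) (hz : z ∈ acsZ s) :
    acsc (z ∘ Equiv.addRight (1 : ZMod s)) = acsc z - acse z 1 := by
  have h1 := acsc_eq z
  have h2 := acsc_eq (z ∘ Equiv.addRight (1 : ZMod s))
  simp only [acs_rot_e z hz, Finset.sum_sub_distrib] at h2
  have h3 := Equiv.sum_comp (Equiv.addRight (1 : ZMod s)) (acse z)
  simp only [Equiv.coe_addRight] at h3
  rw [h3, h1] at h2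
  rw [Finset.sum_const, Finset.card_univ, ZMod.card, nsmul_eq_mul] at h2
  have hs : (s : ℤ) ≠ 0 := by exact_mod_cast NeZero.ne s
  apply mul_left_cancel₀ hs
  linarith

theorem acs_class (f : (ZMod s → ℕ) → ℤ)
    (hf : ∀ z ∈ acsZ s, f (z ∘ Equiv.addRight (1 : ZMod s)) = f z) :
    (s : ℤ) * ∑ z ∈ acsZ s with (acsc z : ZMod s) = 0, f z = ∑ z ∈ acsZ s, f z := by
  have key : ∀ c : ZMod s, ∑ z ∈ acsZ s with (acsc z : ZMod s) = c + 1, f z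
      = ∑ z ∈ acsZ s with (acsc z : ZMod s) = c, f z := by
    intro c
    have h := acs_perm (s + 1) (Equiv.addRight (1 : ZMod s)) (fun z => if (acsc z : ZMod s) = c then f z else 0)
    rw [Finset.sum_filter, Finset.sum_filter]
    change ∑ z ∈ acsZ s, _ = ∑ z ∈ acsZ s, _ at h
    rw [← h]
    apply Finset.sum_congr rfl
    intro z hz
    rw [hf z hz, acs_rot_c z hz]
    push_cast
    simp only [acse_cast, sub_eq_iff_eq_add]
  have key2 : ∀ n : ℕ, ∑ z ∈ acsZ s with (acsc z : ZMod s) = (n : ZMod s), f z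
      = ∑ z ∈ acsZ s with (acsc z : ZMod s) = 0, f z := by
    intro n
    induction n with
    | zero => simp
    | succ n ih => push_cast; rw [key, ih]
  rw [← Finset.sum_fiberwise (acsZ s) (fun z => (acsc z : ZMod s)) f]
  have key3 : ∀ c : ZMod s, ∑ z ∈ acsZ s with (acsc z : ZMod s) = c, f z
      = ∑ z ∈ acsZ s with (acsc z : ZMod s) = 0, f z := by
    intro c
    have := key2 c.val
    simpa using this
  simp only [key3]
  rw [Finset.sum_const, Finset.card_univ, ZMod.card, nsmul_eq_mul]

end

section

/-- strictly increasing sequence -/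
def acsx (p : YPartition) (i : ℕ) : ℤ := (i : ℤ) - p.parts i

theorem acsx_mono (p : YPartition) : StrictMono (acsx p) := by
  apply strictMono_nat_of_lt_succ
  intro n
  have := p.antitone (Nat.le_succ n)
  simp only [acsx]
  push_cast
  simp only [Nat.succ_eq_add_one] at this
  omega

theorem acsx_inj (p q : YPartition) (h : Set.range (acsx p) = Set.range (acsx q)) : p = q := by
  have h1 := (StrictMono.range_inj (acsx_mono p) (acsx_mono q)).1 h
  have h2 : p.parts = q.parts := by
    funext i
    have := congrFun h1 i
    simp only [acsx] at this
    omega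
  cases p; cases q; simp_all

theorem acs_conj (p : YPartition) (j k : ℕ) (h : ∀ i, j < p.parts i ↔ i < k) : p.conj j = k := by
  unfold YPartition.conj
  have : {i : ℕ | j < p.parts i} = ((range k : Finset ℕ) : Set ℕ) := by
    ext i; simp [h]
  rw [this, Set.ncard_coe_finset, card_range]

theorem acs_conj_ex (p : YPartition) (j : ℕ) : ∃ k, ∀ i, j < p.parts i ↔ i < k := by
  classical
  obtain ⟨N, hN⟩ := p.finite_support
  have hex : ∃ i, p.parts i ≤ j := ⟨N, by rw [hN N le_rfl]; omega⟩
  refine ⟨Nat.find hex, fun i => ?_⟩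
  constructor
  · intro h
    by_contra h'
    have h1 := Nat.find_spec hex
    have h2 := p.antitone (not_lt.1 h')
    omega
  · intro h
    have := Nat.find_min hex h
    omega

theorem acs_core (p : YPartition) (t : ℕ) (ht : 0 < t) :
    YPartition.IsCore t p ↔ ∀ m ∈ Set.range (acsx p), m + t ∈ Set.range (acsx p) := by
  classical
  constructor
  · rintro h _ ⟨i, rfl⟩
    by_contra hn
    have hex : ∃ k, acsx p i + t < acsx p k := by
      refine ⟨i + t + p.parts 0 + 1, ?_⟩
      have := p.antitone (Nat.zero_le (i + t + p.parts 0 + 1))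
      simp only [acsx]
      push_cast
      omega
    obtain ⟨k, hk, hmin⟩ : ∃ k, acsx p i + t < acsx p k ∧ ∀ l < k, ¬ (acsx p i + t < acsx p l) :=
      ⟨Nat.find hex, Nat.find_spec hex, fun l hl => Nat.find_min hex hl⟩
    have hik : i < k := by
      apply (acsx_mono p).lt_iff_lt.1
      omega
    obtain ⟨k, rfl⟩ : ∃ l, k = l + 1 := ⟨k - 1, by omega⟩
    have h1 : acsx p k < acsx p i + t := by
      rcases lt_or_eq_of_le (not_lt.1 (hmin k (by omega))) with h | h
      · exact h
      · exact absurd ⟨k, h⟩ hn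
    simp only [acsx] at h1 hk
    push_cast at hk
    obtain ⟨j, hj⟩ : ∃ j : ℕ, (j : ℤ) = k - ((i : ℤ) - p.parts i + t) :=
      ⟨(k - ((i : ℤ) - p.parts i + t)).toNat, by omega⟩
    have hc : ∀ i', j < p.parts i' ↔ i' < k + 1 := by
      intro i'
      constructor
      · intro h2
        by_contra h3
        have := p.antitone (not_lt.1 h3)
        omega
      · intro h2
        have := p.antitone (Nat.lt_succ_iff.1 h2)
        omega
    have hcj := acs_conj p j _ hc
    refine h i j ((hc i).2 hik) ?_
    unfold YPartition.hook
    rw [hcj]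
    omega
  · intro h i j hij hh
    obtain ⟨k, hk⟩ := acs_conj_ex p j
    have hcj := acs_conj p j k hk
    unfold YPartition.hook at hh
    rw [hcj] at hh
    change j < p.parts i at hij
    have hik := (hk i).1 hij
    obtain ⟨k, rfl⟩ : ∃ l, k = l + 1 := ⟨k - 1, by omega⟩
    obtain ⟨l, hl⟩ := h (acsx p i) ⟨i, rfl⟩
    have h1 := (hk k).2 (by omega)
    have h2 : ¬ j < p.parts (k + 1) := fun h => by have := (hk (k + 1)).1 h; omega
    have h3 : acsx p k < acsx p l := by rw [hl]; simp only [acsx]; omega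
    have h4 : acsx p l < acsx p (k + 1) := by rw [hl]; simp only [acsx]; push_cast; omega
    have h5 := (acsx_mono p).lt_iff_lt.1 h3
    have h6 := (acsx_mono p).lt_iff_lt.1 h4
    omega

theorem acs_size (p : YPartition) (N : ℕ) (hN : ∀ i, N ≤ i → p.parts i = 0) :
    p.size = ∑ i ∈ range N, p.parts i := by
  unfold YPartition.size
  have : p.cells = ((((range N).sigma (fun i => range (p.parts i))).map
      (Equiv.sigmaEquivProd ℕ ℕ).toEmbedding : Finset (ℕ × ℕ)) : Set (ℕ × ℕ)) := by
    ext ⟨i, j⟩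
    simp only [YPartition.cells, Set.mem_ofPred_eq, coe_map, Set.mem_image, mem_coe, mem_sigma, mem_range]
    constructor
    · intro h
      refine ⟨⟨i, j⟩, ⟨?_, h⟩, rfl⟩
      by_contra h'
      have := hN i (not_lt.1 h')
      omega
    · rintro ⟨⟨a, b⟩, ⟨_, h⟩, h2⟩
      simp at h2
      obtain ⟨rfl, rfl⟩ := h2
      exact h
  rw [this, Set.ncard_coe_finset, card_map, card_sigma]
  simp

variable {s : ℕ} [NeZero s]

theorem acs_class_le (a b : ℤ) (h : (a : ZMod s) = (b : ZMod s)) (hab : a < b) : a + s ≤ b := by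
  have h1 : ((b - a : ℤ) : ZMod s) = 0 := by push_cast; rw [h]; ring
  rw [ZMod.intCast_zmod_eq_zero_iff_dvd] at h1
  have := Int.le_of_dvd (by omega) h1
  omega

theorem acs_key (x : ℕ → ℤ) (hx : StrictMono x) (N : ℕ) (hN : ∀ k : ℕ, x (N + k) = x N + k)
    (e : ZMod s → ℤ) (he : ∀ r, (e r : ZMod s) = r) (hM : ∀ m, m ∈ Set.range x ↔ e (m : ZMod s) ≤ m)
    (g : ℤ → ℤ) :
    ∑ r, g (e r) + ∑ i ∈ range N, g (x i + s) = ∑ i ∈ range (N + s), g (x i) := by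
  classical
  have hs : 0 < s := Nat.pos_of_ne_zero (NeZero.ne s)
  have hinj : Function.Injective e := fun a b h => by rw [← he a, ← he b, h]
  have hr : ∀ r, e r < x N + s := by
    intro r
    have hv := ZMod.val_lt (r - (x N : ZMod s))
    have h1 := (hM _).1 ⟨_, hN (r - (x N : ZMod s)).val⟩
    have h2 : ((x N + (r - (x N : ZMod s)).val : ℤ) : ZMod s) = r := by
      push_cast
      rw [ZMod.natCast_zmod_val]; ring
    rw [h2] at h1
    omega
  have hA : ∑ r, g (e r) = ∑ m ∈ univ.image e, g m := by
    rw [sum_image]; exact fun a _ b _ h => hinj h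
  have hB : ∑ i ∈ range N, g (x i + s) = ∑ m ∈ (range N).image (fun i => x i + s), g m := by
    rw [sum_image]; exact fun a _ b _ h => hx.injective (by simpa using h)
  have hC : ∑ i ∈ range (N + s), g (x i) = ∑ m ∈ (range (N + s)).image x, g m := by
    rw [sum_image]; exact fun a _ b _ h => hx.injective h
  rw [hA, hB, hC, ← sum_union]
  · congr 1
    ext m
    simp only [mem_union, mem_image, mem_univ, true_and, mem_range]
    constructor
    · rintro (⟨r, rfl⟩ | ⟨i, hi, rfl⟩)
      · obtain ⟨j, hj⟩ := (hM (e r)).2 (by rw [he])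
        refine ⟨j, ?_, hj⟩
        apply hx.lt_iff_lt.1
        rw [hN s, hj]; exact hr r
      · obtain ⟨j, hj⟩ := (hM (x i + s)).2 (by
          have := (hM (x i)).1 ⟨i, rfl⟩
          push_cast
          simp only [CharP.cast_eq_zero, add_zero]
          omega)
        refine ⟨j, ?_, hj⟩
        apply hx.lt_iff_lt.1
        rw [hN s, hj]
        have := hx hi
        omega
    · rintro ⟨i, hi, rfl⟩
      have h1 := (hM (x i)).1 ⟨i, rfl⟩
      rcases eq_or_lt_of_le h1 with h | h
      · exact Or.inl ⟨_, h⟩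
      · right
        have h2 := acs_class_le _ _ (he _) h
        obtain ⟨j, hj⟩ := (hM (x i - s)).2 (by
          push_cast
          simp only [CharP.cast_eq_zero, sub_zero]
          omega)
        refine ⟨j, ?_, by omega⟩
        have := hx hi
        rw [hN s] at this
        apply hx.lt_iff_lt.1
        omega
  · rw [Finset.disjoint_left]
    intro m h1 h2
    simp only [mem_image, mem_univ, true_and, mem_range] at h1 h2
    obtain ⟨r, rfl⟩ := h1
    obtain ⟨i, hi, h⟩ := h2
    have h1 := (hM (x i)).1 ⟨i, rfl⟩
    have h3 : ((x i : ℤ) : ZMod s) = r := by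
      have := congrArg (Int.cast : ℤ → ZMod s) h
      push_cast at this
      rw [he] at this
      simpa using this
    rw [h3] at h1
    omega

/-- the relation between a partition and its vector -/
def acsR (p : YPartition) (e : ZMod s → ℤ) : Prop := ∀ m : ℤ, m ∈ Set.range (acsx p) ↔ e (m : ZMod s) ≤ m

theorem acs_sum_id (s : ℕ) (c : ℤ) : ∑ i ∈ range s, (c + i : ℤ) = s * c + ∑ i ∈ range s, (i : ℤ) := by
  rw [sum_add_distrib]; simp

theorem acs_val_sum (f : ℤ → ℤ) : ∑ r : ZMod s, f r.val = ∑ i ∈ range s, f i := by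
  rw [acs_sum_zmod]
  apply sum_congr rfl
  intro i hi
  rw [ZMod.val_cast_of_lt (by simpa using hi)]

theorem acsR_sums (p : YPartition) (e : ZMod s → ℤ) (he : ∀ r, (e r : ZMod s) = r) (hR : acsR p e) :
    ∑ r, e r = ∑ r : ZMod s, (r.val : ℤ) ∧
    ∑ r, e r ^ 2 = 2 * s * p.size + ∑ r : ZMod s, (r.val : ℤ) ^ 2 := by
  obtain ⟨N, hN⟩ := p.finite_support
  have hx : ∀ k : ℕ, acsx p (N + k) = N + k := by
    intro k; simp [acsx, hN (N + k) (by omega)]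
  have hx0 : acsx p N = N := by simpa using hx 0
  have hk := acs_key (acsx p) (acsx_mono p) N (by intro k; rw [hx, hx0]) e he hR
  have h1 := hk id
  have h2 := hk (fun x => x ^ 2)
  rw [sum_range_add] at h1 h2
  simp only [id, hx] at h1 h2
  rw [acs_val_sum (fun x => x), acs_val_sum (fun x => x ^ 2)]
  rw [sum_add_distrib, sum_add_distrib] at h1
  simp only [sum_const, card_range, nsmul_eq_mul] at h1
  refine ⟨by linarith, ?_⟩
  simp only [add_sq, sum_add_distrib, ← mul_sum, ← sum_mul, sum_const, card_range, nsmul_eq_mul] at h2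
  have h3 : ∑ i ∈ range N, acsx p i = ∑ i ∈ range N, (i : ℤ) - p.size := by
    rw [acs_size p N hN]
    simp only [acsx, sum_sub_distrib]
    push_cast; rfl
  have hg : ∀ n : ℕ, 2 * ∑ i ∈ range n, (i : ℤ) = n * (n - 1) := by
    intro n
    induction n with
    | zero => simp
    | succ n ih => rw [sum_range_succ, mul_add, ih]; push_cast; ring
  rw [h3] at h2
  linear_combination h2 - s * hg N + N * hg s

theorem acs_ex_e (p : YPartition) (h1 : YPartition.IsCore s p) (h2 : YPartition.IsCore (s + 1) p) :
    ∃ e : ZMod s → ℤ, (∀ r, (e r : ZMod s) = r) ∧ acsR p e ∧ ∀ r, e (r + 1) ≤ e r + (s + 1) := by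
  have hs : 0 < s := Nat.pos_of_ne_zero (NeZero.ne s)
  rw [acs_core p s hs] at h1
  rw [acs_core p (s + 1) (by omega)] at h2
  obtain ⟨N, hN⟩ := p.finite_support
  have hex : ∀ r : ZMod s, ∃ m : ℤ, ((m ∈ Set.range (acsx p)) ∧ (m : ZMod s) = r) ∧
      ∀ m' : ℤ, ((m' ∈ Set.range (acsx p)) ∧ (m' : ZMod s) = r) → m ≤ m' := by
    intro r
    apply Int.exists_least_of_bdd
    · refine ⟨acsx p 0, ?_⟩
      rintro _ ⟨⟨i, rfl⟩, _⟩
      exact (acsx_mono p).monotone (Nat.zero_le i)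
    · refine ⟨(N + (r - (N : ZMod s)).val : ℕ), ⟨N + (r - (N : ZMod s)).val, ?_⟩, ?_⟩
      · simp [acsx, hN (N + (r - (N : ZMod s)).val) (by omega)]
      · push_cast
        rw [ZMod.natCast_zmod_val]; ring
  choose e he hmin using hex
  refine ⟨e, fun r => (he r).2, ?_, ?_⟩
  · intro m
    constructor
    · intro h
      exact hmin _ m ⟨h, rfl⟩
    · intro h
      have hd : ((m - e (m : ZMod s) : ℤ) : ZMod s) = 0 := by
        push_cast; rw [(he _).2]; ring
      rw [ZMod.intCast_zmod_eq_zero_iff_dvd] at hd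
      obtain ⟨k, hk⟩ := hd
      have hk0 : 0 ≤ k := by
        by_contra hk'
        have : (s : ℤ) * k < 0 := mul_neg_of_pos_of_neg (by exact_mod_cast hs) (by omega)
        omega
      obtain ⟨k, rfl⟩ := Int.eq_ofNat_of_zero_le hk0
      have hcl : ∀ k : ℕ, e (m : ZMod s) + s * k ∈ Set.range (acsx p) := by
        intro k
        induction k with
        | zero => simpa using (he (m : ZMod s)).1
        | succ k ih =>
          have := h1 _ ih
          push_cast
          rw [mul_add, mul_one, ← add_assoc]
          exact this
      have := hcl k
      rwa [show m = e (m : ZMod s) + s * k by omega]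
  · intro r
    apply hmin
    refine ⟨by exact_mod_cast h2 _ (he r).1, ?_⟩
    push_cast
    rw [(he r).2]; simp

theorem acs_gap (x : ℕ → ℤ) (hx : StrictMono x) (i k : ℕ) : x i + k ≤ x (i + k) := by
  induction k with
  | zero => simp
  | succ k ih =>
    have := hx (Nat.lt_succ_self (i + k))
    simp only [Nat.succ_eq_add_one] at this
    rw [← add_assoc]
    push_cast
    omega

theorem acs_ex_p (e : ZMod s → ℤ) (he : ∀ r, (e r : ZMod s) = r) (hst : ∀ r, e (r + 1) ≤ e r + (s + 1))
    (hsum : ∑ r, e r = ∑ r : ZMod s, (r.val : ℤ)) :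
    ∃ p : YPartition, YPartition.IsCore s p ∧ YPartition.IsCore (s + 1) p ∧ acsR p e := by
  classical
  have hs : 0 < s := Nat.pos_of_ne_zero (NeZero.ne s)
  obtain ⟨U, hU⟩ : ∃ U : ℤ, ∀ r, |e r| ≤ U :=
    ⟨∑ r, |e r|, fun r => single_le_sum (f := fun r => |e r|) (fun _ _ => abs_nonneg _) (mem_univ r)⟩
  have hU0 : 0 ≤ U := le_trans (abs_nonneg _) (hU 0)
  let P : ℕ → Prop := fun n => e (((n : ℤ) - U : ℤ) : ZMod s) ≤ (n : ℤ) - U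
  have hPinf : (Set.ofPred P).Infinite := by
    rw [Set.infinite_iff_exists_gt]
    intro a
    refine ⟨a + 1 + (2 * U).toNat, ?_, by omega⟩
    change e _ ≤ _
    have := (abs_le.1 (hU ((((a + 1 + (2 * U).toNat : ℕ) : ℤ) - U : ℤ) : ZMod s))).2
    push_cast at this ⊢
    omega
  let x : ℕ → ℤ := fun i => (Nat.nth P i : ℤ) - U
  have hx : StrictMono x := by
    intro a b h
    have := Nat.nth_strictMono hPinf h
    change (Nat.nth P a : ℤ) - U < Nat.nth P b - U
    omega
  have hM : ∀ m, m ∈ Set.range x ↔ e (m : ZMod s) ≤ m := by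
    intro m
    constructor
    · rintro ⟨i, rfl⟩
      exact Nat.nth_mem_of_infinite hPinf i
    · intro h
      have h1 := (abs_le.1 (hU (m : ZMod s))).1
      obtain ⟨n, hn⟩ := Int.eq_ofNat_of_zero_le (show 0 ≤ m + U by omega)
      have hm : m = (n : ℤ) - U := by omega
      have hP : P n := by
        change e _ ≤ _
        rw [← hm]; exact h
      have h2 : n ∈ Set.range (Nat.nth P) := by
        rw [Nat.range_nth_of_infinite hPinf]; exact hP
      obtain ⟨i, hi⟩ := h2
      exact ⟨i, by change (Nat.nth P i : ℤ) - U = m; omega⟩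
  obtain ⟨N, hNU⟩ : ∃ N, U ≤ x N := by
    refine ⟨(2 * U).toNat, ?_⟩
    have := acs_gap x hx 0 (2 * U).toNat
    have h0 : -U ≤ x 0 := by change -U ≤ (Nat.nth P 0 : ℤ) - U; omega
    rw [zero_add] at this
    omega
  have hN : ∀ k : ℕ, x (N + k) = x N + k := by
    intro k
    induction k with
    | zero => simp
    | succ k ih =>
      have h1 := acs_gap x hx N (k + 1)
      obtain ⟨j, hj⟩ := (hM (x N + (k + 1 : ℕ))).2 (by
        have := (abs_le.1 (hU ((x N + (k + 1 : ℕ) : ℤ) : ZMod s))).2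
        omega)
      have h2 : N + k < j := by
        apply hx.lt_iff_lt.1
        rw [hj, ih]; push_cast; omega
      have h3 := hx.monotone (Nat.succ_le_of_lt h2)
      rw [hj] at h3
      exact le_antisymm h3 h1
  have hkey := acs_key x hx N hN e he hM id
  rw [sum_range_add] at hkey
  simp only [id, hN] at hkey
  rw [hsum, acs_val_sum (fun x => x), sum_add_distrib, sum_add_distrib] at hkey
  simp only [sum_const, card_range, nsmul_eq_mul] at hkey
  have hxN : x N = N := by
    have : (s : ℤ) ≠ 0 := by exact_mod_cast hs.ne'
    apply mul_left_cancel₀ this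
    linarith
  have hle : ∀ i, x i ≤ i := by
    intro i
    have h1 := acs_gap x hx i N
    rw [add_comm i N, hN, hxN] at h1
    omega
  let p : YPartition :=
    { parts := fun i => ((i : ℤ) - x i).toNat
      antitone := by
        intro i j hij
        obtain ⟨k, rfl⟩ := Nat.exists_eq_add_of_le hij
        have := acs_gap x hx i k
        push_cast
        omega
      finite_support := by
        refine ⟨N, fun i hi => ?_⟩
        obtain ⟨k, rfl⟩ := Nat.exists_eq_add_of_le hi
        rw [hN, hxN]
        push_cast
        omega }
  have hpx : acsx p = x := by
    funext i
    have := hle i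
    change (i : ℤ) - (((i : ℤ) - x i).toNat : ℕ) = x i
    omega
  have hR : acsR p e := by
    intro m; rw [hpx]; exact hM m
  refine ⟨p, ?_, ?_, hR⟩
  · rw [acs_core p s hs]
    intro m hm
    rw [hR] at hm ⊢
    push_cast
    simp only [CharP.cast_eq_zero, add_zero]
    omega
  · rw [acs_core p (s + 1) (by omega)]
    intro m hm
    rw [hR] at hm ⊢
    have := hst (m : ZMod s)
    push_cast
    simp only [CharP.cast_eq_zero, zero_add]
    omega

end

section
variable {s : ℕ} [NeZero s]

/-- the normalised vector -/
def acsI (z : ZMod s → ℕ) (r : ZMod s) : ℤ := acse z r - acsc z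

/-- compositions in the zero class -/
def acsZ0 (s : ℕ) [NeZero s] : Finset (ZMod s → ℕ) := (acsZ s).filter (fun z => (acsc z : ZMod s) = 0)

theorem acsI_cast (z : ZMod s → ℕ) (hz : z ∈ acsZ0 s) (r : ZMod s) : (acsI z r : ZMod s) = r := by
  unfold acsI
  push_cast
  rw [acse_cast, (mem_filter.1 hz).2, sub_zero]

theorem acsI_step (z : ZMod s → ℕ) (hz : z ∈ acsZ0 s) (r : ZMod s) :
    acsI z (r + 1) = acsI z r + acsW z (r + 1) := by
  unfold acsI
  rw [acse_step z (mem_filter.1 hz).1]; ring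

theorem acsI_sum (z : ZMod s → ℕ) : ∑ r, acsI z r = ∑ r : ZMod s, (r.val : ℤ) := by
  unfold acsI
  rw [sum_sub_distrib, acsc_eq, sum_const, card_univ, ZMod.card, nsmul_eq_mul]; ring

theorem acsI_ex (z : ZMod s → ℕ) (hz : z ∈ acsZ0 s) :
    ∃ p : YPartition, YPartition.IsCore s p ∧ YPartition.IsCore (s + 1) p ∧ acsR p (acsI z) := by
  apply acs_ex_p _ (acsI_cast z hz) _ (acsI_sum z)
  intro r
  rw [acsI_step z hz]
  unfold acsW
  have : (0 : ℤ) ≤ s * z (r + 1) := by positivity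
  omega

theorem acsR_unique (p : YPartition) (e e' : ZMod s → ℤ) (he : ∀ r, (e r : ZMod s) = r)
    (he' : ∀ r, (e' r : ZMod s) = r) (h : acsR p e) (h' : acsR p e') : e = e' := by
  funext r
  apply le_antisymm
  · have h1 := (h (e' r)).1 ((h' (e' r)).2 (by rw [he']))
    rwa [he'] at h1
  · have h1 := (h' (e r)).1 ((h (e r)).2 (by rw [he]))
    rwa [he] at h1

theorem acsI_inj (z z' : ZMod s → ℕ) (hz : z ∈ acsZ0 s) (hz' : z' ∈ acsZ0 s) (h : acsI z = acsI z') : z = z' := by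
  have hs : (s : ℤ) ≠ 0 := by exact_mod_cast NeZero.ne s
  funext r
  have h1 := acsI_step z hz (r - 1)
  have h2 := acsI_step z' hz' (r - 1)
  rw [h, h2] at h1
  simp only [sub_add_cancel, acsW] at h1
  have h3 : (s : ℤ) * z r = s * z' r := by linarith
  exact_mod_cast mul_left_cancel₀ hs h3

theorem acsI_surj (e : ZMod s → ℤ) (he : ∀ r, (e r : ZMod s) = r) (hst : ∀ r, e (r + 1) ≤ e r + (s + 1))
    (hsum : ∑ r, e r = ∑ r : ZMod s, (r.val : ℤ)) : ∃ z ∈ acsZ0 s, acsI z = e := by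
  have hs : (s : ℤ) ≠ 0 := by exact_mod_cast NeZero.ne s
  have hs0 : (0 : ℤ) < s := by have := NeZero.pos s; omega
  have hex : ∀ r : ZMod s, ∃ n : ℕ, (s : ℤ) * n = s + 1 - (e r - e (r - 1)) := by
    intro r
    have h1 : (((s : ℤ) + 1 - (e r - e (r - 1)) : ℤ) : ZMod s) = 0 := by
      push_cast
      rw [he, he]; simp
    rw [ZMod.intCast_zmod_eq_zero_iff_dvd] at h1
    obtain ⟨k, hk⟩ := h1
    have h2 := hst (r - 1)
    rw [sub_add_cancel] at h2
    have hk0 : 0 ≤ k := by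
      by_contra hk'
      have : (s : ℤ) * k < 0 := mul_neg_of_pos_of_neg hs0 (by omega)
      omega
    obtain ⟨n, rfl⟩ := Int.eq_ofNat_of_zero_le hk0
    exact ⟨n, hk.symm⟩
  choose z hz using hex
  have hZ : z ∈ acsZ s := by
    rw [acs_memZ]
    have h1 : ∑ r, (s : ℤ) * z r = ∑ r, ((s : ℤ) + 1 - (e r - e (r - 1))) := sum_congr rfl (fun r _ => hz r)
    have h2 := Equiv.sum_comp (Equiv.subRight (1 : ZMod s)) e
    simp only [Equiv.subRight_apply] at h2
    rw [← mul_sum, sum_sub_distrib, sum_sub_distrib, h2, sum_const, card_univ, ZMod.card, nsmul_eq_mul,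
      sub_self, sub_zero] at h1
    exact_mod_cast mul_left_cancel₀ hs h1
  have hW : ∀ r, e (r + 1) = e r + acsW z (r + 1) := by
    intro r
    have := hz (r + 1)
    rw [add_sub_cancel_right] at this
    unfold acsW
    omega
  have hd : ∀ r, acse z r = e r - e 0 := by
    intro r
    have := acs_ext (acse z) e (acsW z) (acse_step z hZ) hW r
    rwa [acse_zero, sub_zero] at this
  have hc : acsc z = - e 0 := by
    have h1 := acsc_eq z
    simp only [hd, sum_sub_distrib] at h1
    rw [hsum, sum_const, card_univ, ZMod.card, nsmul_eq_mul] at h1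
    apply mul_left_cancel₀ hs
    linarith
  refine ⟨z, mem_filter.2 ⟨hZ, ?_⟩, ?_⟩
  · rw [hc]; push_cast; rw [he]; simp
  · funext r
    unfold acsI
    rw [hd, hc]; ring

theorem acs_gauss (n : ℕ) : 2 * ∑ i ∈ range n, (i : ℤ) = n * (n - 1) := by
  induction n with
  | zero => simp
  | succ n ih => rw [sum_range_succ, mul_add, ih]; push_cast; ring

theorem acs_gauss_sq (n : ℕ) : 6 * ∑ i ∈ range n, (i : ℤ) ^ 2 = n * (n - 1) * (2 * n - 1) := by
  induction n with
  | zero => simp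
  | succ n ih => rw [sum_range_succ, mul_add, ih]; push_cast; ring

theorem acs_size_eq (p : YPartition) (z : ZMod s → ℕ) (hz : z ∈ acsZ0 s) (hR : acsR p (acsI z)) :
    24 * (s : ℤ) ^ 2 * p.size = 6 * acsV (acse z) - s ^ 2 * (s ^ 2 - 1) := by
  have h1 := (acsR_sums p (acsI z) (acsI_cast z hz) hR).2
  have h2 : acsV (acse z) = acsV (acsI z) := by
    unfold acsV acsI
    simp only [sub_sub_sub_cancel_right]
  rw [h2, acsV_eq, h1, acsI_sum, acs_val_sum (fun x => x), acs_val_sum (fun x => x ^ 2)]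
  have h3 := acs_gauss s
  have h4 := acs_gauss_sq s
  generalize ∑ i ∈ range s, (i : ℤ) = K at *
  generalize ∑ i ∈ range s, (i : ℤ) ^ 2 = K2 at *
  linear_combination (6 * K + 3 * s * (s - 1)) * h3 - 2 * s * h4

theorem acs_total (f : (ZMod s → ℕ) → ℕ)
    (hf : ∀ z ∈ acsZ0 s, 24 * (s : ℤ) ^ 2 * f z = 6 * acsV (acse z) - s ^ 2 * (s ^ 2 - 1)) :
    2 * (s + 1) * ∑ z ∈ acsZ0 s, f z = Nat.choose (s + 1) 3 * Nat.choose (2 * s) s := by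
  have hs : (s : ℤ) ≠ 0 := by exact_mod_cast NeZero.ne s
  have h1 := sum_congr rfl hf
  rw [← mul_sum, sum_sub_distrib, ← mul_sum] at h1
  have h2 := acs_class (s := s) (fun z => acsV (acse z)) (fun z hz => acs_rot_V z hz)
  have h3 := acs_class (s := s) (fun _ => 1) (fun z hz => rfl)
  have h4 := acs_sumV (s := s)
  change (s : ℤ) * ∑ z ∈ acsZ0 s, _ = _ at h2 h3
  simp only [sum_const, nsmul_eq_mul, mul_one] at h1 h3
  have hN : (s + 1) * (acsZ s).card = s * (2 * s).choose s := by
    unfold acsZ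
    rw [acs_card, ZMod.card, show s + (s + 1) - 1 = 2 * s by omega]
    have := Nat.choose_succ_right_eq (2 * s) s
    rw [show 2 * s - s = s by omega] at this
    linarith
  have hC : (6 : ℤ) * (s + 1).choose 3 = (s + 1) * s * (s - 1) := by
    obtain ⟨t, rfl⟩ : ∃ t, s = t + 1 := ⟨s - 1, by have := NeZero.pos s; omega⟩
    have h := Nat.descFactorial_eq_factorial_mul_choose (t + 1 + 1) 3
    simp [Nat.descFactorial, Nat.factorial] at h
    zify at h
    push_cast
    linarith
  have h5 : 12 * (∑ z ∈ acsZ0 s, (f z : ℤ)) = (s ^ 2 - 1) * (acsZ s).card := by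
    apply mul_left_cancel₀ (pow_ne_zero 3 hs)
    apply mul_left_cancel₀ (show (2 : ℤ) ≠ 0 by norm_num)
    linear_combination s * h1 + 6 * h2 + h4 - (s ^ 2 * (s ^ 2 - 1)) * h3
  zify at hN ⊢
  apply mul_left_cancel₀ (show (6 : ℤ) ≠ 0 by norm_num)
  linear_combination (s + 1) * h5 + (s ^ 2 - 1) * hN - (2 * s).choose s * hC


end

end AcsHelpers

open YPartition in
/-- (Stanley–Zanello) The average size of an `(s, s+1)`-core partition is
`C(s+1,3)/2`: the set of `(s,s+1)`-cores is finite (of cardinality the Catalan number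
`C(2s,s)/(s+1)`) and `2(s+1)` times the sum of their sizes is `C(s+1,3) · C(2s,s)`. -/
theorem average_size_s_s1_core (s : ℕ) (hs : 0 < s) :
    {p : YPartition | IsCore s p ∧ IsCore (s + 1) p}.Finite ∧
    2 * (s + 1) * (∑ᶠ p ∈ {p : YPartition | IsCore s p ∧ IsCore (s + 1) p}, p.size)
      = Nat.choose (s + 1) 3 * Nat.choose (2 * s) s := by
  classical
  haveI : NeZero s := ⟨hs.ne'⟩
  let p0 : YPartition := ⟨fun _ => 0, fun _ _ _ => le_rfl, 0, fun _ _ => rfl⟩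
  have hex : ∀ z : ZMod s → ℕ, ∃ p : YPartition, z ∈ acsZ0 s →
      IsCore s p ∧ IsCore (s + 1) p ∧ acsR p (acsI z) := by
    intro z
    by_cases hz : z ∈ acsZ0 s
    · obtain ⟨p, hp⟩ := acsI_ex z hz
      exact ⟨p, fun _ => hp⟩
    · exact ⟨p0, fun h => absurd h hz⟩
  choose Ψ hΨ using hex
  have hbij : Set.BijOn Ψ (acsZ0 s : Set (ZMod s → ℕ)) {p : YPartition | IsCore s p ∧ IsCore (s + 1) p} := by
    refine ⟨?_, ?_, ?_⟩
    · intro z hz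
      have := hΨ z hz
      exact ⟨this.1, this.2.1⟩
    · intro z hz z' hz' h
      have h1 := (hΨ z hz).2.2
      have h2 := (hΨ z' hz').2.2
      rw [← h] at h2
      exact acsI_inj z z' hz hz' (acsR_unique _ _ _ (acsI_cast z hz) (acsI_cast z' hz') h1 h2)
    · rintro p ⟨hp1, hp2⟩
      obtain ⟨e, he, hR, hst⟩ := acs_ex_e p hp1 hp2
      obtain ⟨z, hz, hze⟩ := acsI_surj e he hst (acsR_sums p e he hR).1
      refine ⟨z, hz, ?_⟩
      have h1 := (hΨ z hz).2.2
      rw [hze] at h1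
      apply acsx_inj
      ext m
      rw [h1 m, hR m]
  refine ⟨hbij.finite_iff_finite.1 (Finset.finite_toSet _), ?_⟩
  rw [← finsum_mem_eq_of_bijOn (f := fun z => (Ψ z).size) Ψ hbij (fun _ _ => rfl), finsum_mem_coe_finset]
  exact acs_total _ (fun z hz => acs_size_eq _ z hz (hΨ z hz).2.2)
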